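/- arXiv:1211.3248 — 2 statements merged into one kernel-verified Lean document; each statement's English description precedes it below -/
import Mathlib

section
/- Let d ≥ 1 be an integer, let h be the order of a Hadamard matrix with h ≥ h₀(d) := (e·(π/2)^{d/2}·(d−1)! + d)², and let n = h + d. Then D̄(n) > (2/(π·e))^{d/2}. -/
/-- An `h × h` Hadamard matrix: entries in `{−1, 1}` and `A * Aᵀ = h • I`. -/
def IsHadamardMatrix {h : ℕ} (A : Matrix (Fin h) (Fin h) ℝ) : Prop :=
  (∀ i j, A i j = 1 ∨ A i j = -1) ∧ A * A.transpose = (h : ℝ) • 1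

/-- `h` is the order of some Hadamard matrix. -/
def IsHadamardOrder (h : ℕ) : Prop :=
  ∃ A : Matrix (Fin h) (Fin h) ℝ, IsHadamardMatrix A

/-- `maxDet n = D(n)`: the maximum of `|det M|` over `n × n` `{±1}`-matrices `M`. -/
noncomputable def maxDet (n : ℕ) : ℝ :=
  sSup {x : ℝ | ∃ M : Matrix (Fin n) (Fin n) ℝ,
    (∀ i j, M i j = 1 ∨ M i j = -1) ∧ x = |M.det|}

/-- `maxDetBar n = D̄(n) = D(n) / n^(n/2)`. -/
noncomputable def maxDetBar (n : ℕ) : ℝ :=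
  maxDet n / (n : ℝ) ^ ((n : ℝ) / 2)

open Finset

/-- The sign vector of a finite set: `1` on the set and `-1` off it. -/
noncomputable def signVec {ι : Type*} [DecidableEq ι] (b : Finset ι) (l : ι) : ℝ :=
  if l ∈ b then 1 else -1

section Sign

variable {ι : Type*} [DecidableEq ι]

lemma signVec_eq (b : Finset ι) (l : ι) : signVec b l = 1 ∨ signVec b l = -1 := by
  unfold signVec; split_ifs <;> simp

lemma signVec_sq (b : Finset ι) (l : ι) : signVec b l * signVec b l = 1 := by
  unfold signVec; split_ifs <;> norm_num

lemma signVec_symmDiff (b t : Finset ι) (l : ι) :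
    signVec (symmDiff b t) l = -(signVec t l) * signVec b l := by
  unfold signVec
  by_cases h₁ : l ∈ b <;> by_cases h₂ : l ∈ t <;> simp [Finset.mem_symmDiff, h₁, h₂]

lemma sum_signVec [Fintype ι] (b : Finset ι) :
    ∑ l, signVec b l = 2 * (#b : ℝ) - Fintype.card ι := by
  have h : ∀ l, signVec b l = 2 * (if l ∈ b then 1 else 0) - 1 := by
    intro l; unfold signVec; split_ifs <;> norm_num
  simp only [h, Finset.sum_sub_distrib, ← Finset.mul_sum]
  simp

/-- Sums over all sign vectors are unchanged by multiplying coordinates by fixed signs. -/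
lemma sum_signVec_twist [Fintype ι] (a : ι → ℝ) (ha : ∀ l, a l = 1 ∨ a l = -1)
    (φ : ℝ → ℝ) :
    ∑ b : Finset ι, φ (∑ l, a l * signVec b l) = ∑ b : Finset ι, φ (∑ l, signVec b l) := by
  classical
  let t : Finset ι := Finset.univ.filter fun l => a l = -1
  have inv : Function.Involutive fun b : Finset ι => symmDiff b t := fun b => by
    simp
  rw [← Equiv.sum_comp inv.toPerm]
  refine Finset.sum_congr rfl fun b _ => ?_
  congr 1
  refine Finset.sum_congr rfl fun l _ => ?_
  change a l * signVec (symmDiff b t) l = _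
  rw [signVec_symmDiff]
  rcases ha l with h | h
  · have : signVec t l = -1 := by
      unfold signVec; rw [if_neg]; simp [t, h]; norm_num
    rw [h, this]; ring
  · have : signVec t l = 1 := by
      unfold signVec; rw [if_pos]; simp [t, h]
    rw [h, this]; ring

end Sign

lemma sum_range_choose_mul_sub (n j : ℕ) :
    ∑ k ∈ range j, (n.choose k : ℝ) * (n - 2 * k) = j * n.choose j := by
  induction j with
  | zero => simp
  | succ j ih =>
    rw [Finset.sum_range_succ, ih]
    have h := Nat.choose_succ_right_eq n j
    rcases le_or_gt j n with hj | hj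
    · have h' : (n.choose (j + 1) : ℝ) * (j + 1) = n.choose j * (n - j) := by
        rw [← Nat.cast_sub hj]; exact_mod_cast h
      push_cast
      linarith
    · simp [Nat.choose_eq_zero_of_lt hj, Nat.choose_eq_zero_of_lt (Nat.lt_succ_of_lt hj)]

lemma sum_choose_mul_abs (m : ℕ) :
    ∑ k ∈ range (2 * m + 1), ((2 * m).choose k : ℝ) * |2 * (k : ℝ) - (2 * m : ℕ)|
      = 2 * m * Nat.centralBinom m := by
  have hm : m ≤ 2 * m + 1 := by omega
  have h1 := sum_range_choose_mul_sub (2 * m) m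
  have h2 := sum_range_choose_mul_sub (2 * m) (2 * m + 1)
  rw [Nat.choose_succ_self] at h2
  rw [← Finset.sum_range_add_sum_Ico _ hm] at h2 ⊢
  have e1 : ∑ k ∈ range m, ((2 * m).choose k : ℝ) * |2 * (k : ℝ) - (2 * m : ℕ)|
      = ∑ k ∈ range m, ((2 * m).choose k : ℝ) * ((2 * m : ℕ) - 2 * k) := by
    refine Finset.sum_congr rfl fun k hk => ?_
    have : (k : ℝ) ≤ m := by exact_mod_cast (Finset.mem_range.1 hk).le
    rw [abs_of_nonpos (by push_cast; linarith)]; ring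
  have e2 : ∑ k ∈ Ico m (2 * m + 1), ((2 * m).choose k : ℝ) * |2 * (k : ℝ) - (2 * m : ℕ)|
      = -∑ k ∈ Ico m (2 * m + 1), ((2 * m).choose k : ℝ) * ((2 * m : ℕ) - 2 * k) := by
    rw [← Finset.sum_neg_distrib]
    refine Finset.sum_congr rfl fun k hk => ?_
    have : (m : ℝ) ≤ k := by exact_mod_cast (Finset.mem_Ico.1 hk).1
    rw [abs_of_nonneg (by push_cast; linarith)]; ring
  rw [e1, e2, Nat.centralBinom]
  push_cast at h1 h2 ⊢
  linarith

lemma sum_abs_sum_signVec (m : ℕ) :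
    ∑ b : Finset (Fin (2 * m)), |∑ l, signVec b l| = 2 * m * Nat.centralBinom m := by
  simp only [sum_signVec, Fintype.card_fin]
  have := Finset.sum_powerset_apply_card (x := (Finset.univ : Finset (Fin (2 * m))))
    (fun k : ℕ => |2 * (k : ℝ) - (2 * m : ℕ)|)
  rw [Finset.powerset_univ, Finset.card_univ, Fintype.card_fin] at this
  rw [this, ← sum_choose_mul_abs]
  simp [nsmul_eq_mul]

/-- Wallis lower bound on the central binomial coefficient. -/
lemma sq_four_pow_le_centralBinom (m : ℕ) :
    ((4 : ℝ) ^ m) ^ 2 ≤ Real.pi / 2 * (2 * m + 1) * (Nat.centralBinom m : ℝ) ^ 2 := by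
  have h := Real.Wallis.W_le m
  rw [Real.Wallis.W_eq_factorial_ratio] at h
  have hc : (Nat.centralBinom m : ℝ) * (m.factorial : ℝ) ^ 2 = ((2 * m).factorial : ℝ) := by
    have := Nat.choose_mul_factorial_mul_factorial (n := 2 * m) (k := m) (by omega)
    rw [show 2 * m - m = m by omega] at this
    rw [← this, Nat.centralBinom]; push_cast; ring
  have hf : (0 : ℝ) < m.factorial := by positivity
  rw [← hc, div_le_iff₀ (by have := Nat.centralBinom_pos m; positivity)] at h
  have hf4 : (0 : ℝ) < (m.factorial : ℝ) ^ 4 := by positivity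
  refine le_of_mul_le_mul_right ?_ hf4
  calc ((4 : ℝ) ^ m) ^ 2 * (m.factorial : ℝ) ^ 4
      = 2 ^ (4 * m) * (m.factorial : ℝ) ^ 4 := by
        rw [← pow_mul, show (4 : ℝ) = 2 ^ 2 by norm_num, ← pow_mul]; ring_nf
    _ ≤ _ := h
    _ = _ := by ring

/-- Any set of entries of a square matrix can be perturbed by `±1` without decreasing the
determinant. -/
lemma exists_perturb_det_le {κ : Type*} [Fintype κ] [DecidableEq κ]
    (M : Matrix κ κ ℝ) (S : Finset (κ × κ)) :
    ∃ N : Matrix κ κ ℝ, (∀ p ∈ S, N p.1 p.2 = M p.1 p.2 + 1 ∨ N p.1 p.2 = M p.1 p.2 - 1) ∧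
      (∀ p ∉ S, N p.1 p.2 = M p.1 p.2) ∧ M.det ≤ N.det := by
  induction S using Finset.induction_on with
  | empty => exact ⟨M, by simp, by simp, le_rfl⟩
  | insert q S hq ih =>
    obtain ⟨N, hN, hN', hd⟩ := ih
    obtain ⟨i, j⟩ := q
    let N' : ℝ → Matrix κ κ ℝ := fun t => N.updateRow i (N i + t • Pi.single j 1)
    have hdet : ∀ t, (N' t).det = N.det + t * (N.updateRow i (Pi.single j 1)).det := by
      intro t
      simp only [N', Matrix.det_updateRow_add, Matrix.det_updateRow_smul,
        Matrix.updateRow_eq_self]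
    have hent : ∀ t k l, N' t k l = N k l + if (k, l) = (i, j) then t else 0 := by
      intro t k l
      by_cases hk : k = i
      · subst hk
        by_cases hl : l = j <;> simp [N', hl]
      · simp [N', hk]
    have key : ∀ t : ℝ, (t = 1 ∨ t = -1) → N.det ≤ (N' t).det →
        ∃ N : Matrix κ κ ℝ, (∀ p ∈ insert (i, j) S,
          N p.1 p.2 = M p.1 p.2 + 1 ∨ N p.1 p.2 = M p.1 p.2 - 1) ∧
        (∀ p ∉ insert (i, j) S, N p.1 p.2 = M p.1 p.2) ∧ M.det ≤ N.det := by
      intro t ht hle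
      refine ⟨N' t, ?_, ?_, hd.trans hle⟩
      · rintro ⟨k, l⟩ hp
        rw [hent]
        by_cases h : (k, l) = (i, j)
        · have h0 := hN' (i, j) hq
          rw [if_pos h]
          obtain ⟨rfl, rfl⟩ := Prod.mk.inj h
          simp only at h0
          rcases ht with rfl | rfl
          · left; simp [h0]
          · right; simp [h0]; ring
        · rw [if_neg h, add_zero]
          exact hN (k, l) ((Finset.mem_insert.1 hp).resolve_left h)
      · rintro ⟨k, l⟩ hp
        rw [Finset.mem_insert, not_or] at hp
        rw [hent, if_neg hp.1, add_zero]
        exact hN' (k, l) hp.2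
    rcases le_total 0 (N.updateRow i (Pi.single j 1)).det with h | h
    · exact key 1 (Or.inl rfl) (by rw [hdet]; linarith)
    · exact key (-1) (Or.inr rfl) (by rw [hdet]; linarith)

lemma bddAbove_abs_det (n : ℕ) :
    BddAbove {x : ℝ | ∃ M : Matrix (Fin n) (Fin n) ℝ,
      (∀ i j, M i j = 1 ∨ M i j = -1) ∧ x = |M.det|} := by
  refine ⟨(Fintype.card (Fin n)).factorial • (1 : ℝ) ^ Fintype.card (Fin n), ?_⟩
  rintro x ⟨M, hM, rfl⟩
  refine Matrix.det_le (abv := AbsoluteValue.abs) fun i j => ?_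
  rcases hM i j with h | h <;> simp [h]

namespace IsHadamardMatrix

variable {h : ℕ} {A : Matrix (Fin h) (Fin h) ℝ}

lemma transpose_mul (hA : IsHadamardMatrix A) (h0 : 0 < h) :
    A.transpose * A = (h : ℝ) • 1 := by
  have hne : (h : ℝ) ≠ 0 := by positivity
  have h1 : A * ((h : ℝ)⁻¹ • A.transpose) = 1 := by
    rw [Matrix.mul_smul, hA.2, smul_smul, inv_mul_cancel₀ hne, one_smul]
  have h2 := mul_eq_one_comm.1 h1
  rw [Matrix.smul_mul] at h2
  rw [← h2, smul_smul, mul_inv_cancel₀ hne, one_smul]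

lemma even_of_two_le (hA : IsHadamardMatrix A) (h2 : 2 ≤ h) : Even h := by
  let i : Fin h := ⟨0, by omega⟩
  let j : Fin h := ⟨1, by omega⟩
  have hij : i ≠ j := by simp [i, j]
  have hs : ∑ k, A i k * A j k = 0 := by
    have := congrFun (congrFun hA.2 i) j
    simpa [Matrix.mul_apply, hij] using this
  have hb := sum_signVec (Finset.univ.filter fun k => A i k * A j k = 1)
  have : ∀ k, signVec (Finset.univ.filter fun k => A i k * A j k = 1) k = A i k * A j k := by
    intro k
    rcases hA.1 i k with h | h <;> rcases hA.1 j k with h' | h' <;>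
      norm_num [signVec, h, h']
  simp only [this, hs, Fintype.card_fin] at hb
  refine ⟨#(Finset.univ.filter fun k => A i k * A j k = 1), ?_⟩
  have : (h : ℝ) = 2 * #(Finset.univ.filter fun k => A i k * A j k = 1) := by linarith
  rw [← two_mul]; exact_mod_cast this

lemma abs_det (hA : IsHadamardMatrix A) : |A.det| = (h : ℝ) ^ ((h : ℝ) / 2) := by
  have h1 : A.det ^ 2 = (h : ℝ) ^ h := by
    have := congrArg Matrix.det hA.2
    rw [Matrix.det_mul, Matrix.det_transpose, Matrix.det_smul] at this
    simpa [sq] using this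
  rw [← Real.sqrt_sq_eq_abs, h1, Real.sqrt_eq_rpow, ← Real.rpow_natCast,
    ← Real.rpow_mul (by positivity)]
  congr 1; ring

end IsHadamardMatrix

/-- Bordering a Hadamard matrix: the Schur complement bounds the maximal determinant below. -/
lemma mul_det_le_maxDet {h d : ℕ} (h0 : 0 < h) {A : Matrix (Fin h) (Fin h) ℝ}
    (hA : IsHadamardMatrix A) (B : Matrix (Fin h) (Fin d) ℝ)
    (hB : ∀ i j, B i j = 1 ∨ B i j = -1) (C : Matrix (Fin d) (Fin h) ℝ)
    (hC : ∀ i j, C i j = 1 ∨ C i j = -1) :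
    (h : ℝ) ^ ((h : ℝ) / 2) * (1 + (h : ℝ)⁻¹ • (C * (A.transpose * B))).det
      ≤ maxDet (h + d) := by
  set F : Matrix (Fin d) (Fin d) ℝ := (h : ℝ)⁻¹ • (C * (A.transpose * B)) with hF
  obtain ⟨N, hN, hN', hdet⟩ := exists_perturb_det_le (1 + F) Finset.univ.offDiag
  have hne : (h : ℝ) ≠ 0 := by positivity
  have hinv : ((h : ℝ)⁻¹ • A.transpose) * A = 1 := by
    rw [Matrix.smul_mul, hA.transpose_mul h0, smul_smul, inv_mul_cancel₀ hne, one_smul]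
  have hinv' : A * ((h : ℝ)⁻¹ • A.transpose) = 1 := mul_eq_one_comm.1 hinv
  let _ : Invertible A := ⟨_, hinv, hinv'⟩
  let M := Matrix.fromBlocks A B (-C) (N - F)
  have hMdet : M.det = A.det * N.det := by
    rw [Matrix.det_fromBlocks₁₁]
    congr 2
    change N - F - -C * ((h : ℝ)⁻¹ • A.transpose) * B = N
    rw [hF]
    simp [Matrix.mul_assoc]
  have hM : ∀ i j, M i j = 1 ∨ M i j = -1 := by
    rintro (i | i) (j | j)
    · exact hA.1 i j
    · exact hB i j
    · change -C i j = 1 ∨ -C i j = -1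
      rcases hC i j with h | h <;> simp [h]
    · change N i j - F i j = 1 ∨ N i j - F i j = -1
      by_cases hij : i = j
      · subst hij
        have : N i i = (1 + F) i i := hN' (i, i) (by simp)
        left; simp [this]
      · have := hN (i, j) (by simp [hij])
        simp only [Matrix.add_apply, Matrix.one_apply_ne hij, zero_add] at this
        rcases this with h | h
        · left; linarith
        · right; linarith
  have hle : |M.det| ≤ maxDet (h + d) := by
    refine le_csSup (bddAbove_abs_det _)
      ⟨Matrix.reindex finSumFinEquiv finSumFinEquiv M, ?_, ?_⟩
    · intro i j; exact hM _ _
    · rw [Matrix.det_reindex_self]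
  rw [hMdet, abs_mul, hA.abs_det] at hle
  refine le_trans ?_ hle
  gcongr
  exact hdet.trans (le_abs_self _)

lemma sum_sq_vecMul_of_mul_transpose {h : ℕ} {M : Matrix (Fin h) (Fin h) ℝ} {r : ℝ}
    (hM : M * M.transpose = r • 1) (s : Fin h → ℝ) :
    ∑ k, (∑ l, M l k * s l) ^ 2 = r * ∑ l, s l ^ 2 := by
  have h1 : ∑ k, (∑ l, M l k * s l) ^ 2
      = dotProduct (Matrix.vecMul s M) (Matrix.vecMul s M) := by
    refine Finset.sum_congr rfl fun k _ => ?_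
    rw [sq]; simp [Matrix.vecMul, dotProduct, mul_comm]
  have h2 : Matrix.vecMul s M = Matrix.mulVec M.transpose s := (Matrix.mulVec_transpose M s).symm
  rw [h1]
  nth_rewrite 2 [h2]
  rw [← Matrix.dotProduct_mulVec, Matrix.mulVec_mulVec, hM, Matrix.smul_mulVec,
    Matrix.one_mulVec, dotProduct_smul]
  simp [dotProduct, sq]

/-- Second moment of a random signed sum. -/
lemma sum_sq_sum_mul_signVec {ι : Type*} [Fintype ι] [DecidableEq ι] (u : ι → ℝ) :
    ∑ b : Finset ι, (∑ l, u l * signVec b l) ^ 2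
      = (Fintype.card (Finset ι) : ℝ) * ∑ l, u l ^ 2 := by
  have hcov : ∀ l m : ι, ∑ b : Finset ι, signVec b l * signVec b m
      = if l = m then (Fintype.card (Finset ι) : ℝ) else 0 := by
    intro l m
    by_cases hlm : l = m
    · subst hlm; simp [signVec_sq]
    · rw [if_neg hlm]
      have inv : Function.Involutive fun b : Finset ι => symmDiff b {l} := fun b => by simp
      have key : ∑ b : Finset ι, signVec b l * signVec b m
          = -∑ b : Finset ι, signVec b l * signVec b m := by
        nth_rewrite 1 [← Equiv.sum_comp inv.toPerm]
        rw [← Finset.sum_neg_distrib]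
        refine Finset.sum_congr rfl fun b _ => ?_
        change signVec (symmDiff b {l}) l * signVec (symmDiff b {l}) m = _
        rw [signVec_symmDiff, signVec_symmDiff]
        have h1 : signVec {l} l = 1 := by simp [signVec]
        have h2 : signVec {l} m = -1 := by
          simp [signVec, Ne.symm hlm]
        rw [h1, h2]; ring
      linarith
  calc ∑ b : Finset ι, (∑ l, u l * signVec b l) ^ 2
      = ∑ b : Finset ι, ∑ l, ∑ m, u l * u m * (signVec b l * signVec b m) := by
        refine Finset.sum_congr rfl fun b _ => ?_
        rw [sq, Finset.sum_mul_sum]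
        refine Finset.sum_congr rfl fun l _ => Finset.sum_congr rfl fun m _ => ?_
        ring
    _ = ∑ l, ∑ m, u l * u m * ∑ b : Finset ι, signVec b l * signVec b m := by
        rw [Finset.sum_comm]
        refine Finset.sum_congr rfl fun l _ => ?_
        rw [Finset.sum_comm]
        simp only [Finset.mul_sum]
    _ = _ := by
        simp only [hcov, mul_ite, mul_zero, Finset.sum_ite_eq, Finset.mem_univ, if_true,
          Finset.mul_sum]
        refine Finset.sum_congr rfl fun l _ => ?_
        ring

section Border

variable {h : ℕ} (A : Matrix (Fin h) (Fin h) ℝ)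

/-- The correlations of a random sign column with the columns of `A`. -/
noncomputable def correlation (b : Finset (Fin h)) (k : Fin h) : ℝ :=
  ∑ l, A l k * signVec b l

/-- The signs of the correlations. -/
noncomputable def correlationSign (b : Finset (Fin h)) (k : Fin h) : ℝ :=
  if 0 ≤ correlation A b k then 1 else -1

/-- An entry of the Schur complement of the bordered matrix. -/
noncomputable def schurEntry (b b' : Finset (Fin h)) : ℝ :=
  (h : ℝ)⁻¹ * ∑ k, correlationSign A b k * correlation A b' k

lemma correlationSign_eq (b : Finset (Fin h)) (k : Fin h) :
    correlationSign A b k = 1 ∨ correlationSign A b k = -1 := by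
  unfold correlationSign; split_ifs <;> simp

lemma sum_correlationSign_sq (b : Finset (Fin h)) :
    ∑ k, correlationSign A b k ^ 2 = h := by
  have : ∀ k, correlationSign A b k ^ 2 = 1 := fun k => by
    rcases correlationSign_eq A b k with h | h <;> simp [h]
  simp [this]

variable {A}

lemma sum_correlation_sq (hA : IsHadamardMatrix A) (b : Finset (Fin h)) :
    ∑ k, correlation A b k ^ 2 = (h : ℝ) * h := by
  unfold correlation
  rw [sum_sq_vecMul_of_mul_transpose hA.2]
  simp [sq, signVec_sq]

lemma abs_schurEntry_le (hA : IsHadamardMatrix A) (h0 : 0 < h) (b b' : Finset (Fin h)) :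
    |schurEntry A b b'| ≤ √h := by
  apply Real.abs_le_sqrt
  have := Finset.sum_mul_sq_le_sq_mul_sq Finset.univ (correlationSign A b) (correlation A b')
  rw [sum_correlationSign_sq, sum_correlation_sq hA] at this
  have hp : (0 : ℝ) < h := by positivity
  unfold schurEntry
  rw [mul_pow]
  calc _ ≤ ((h : ℝ)⁻¹) ^ 2 * (h * (h * h)) := by gcongr
    _ = h := by field_simp

lemma sum_schurEntry_self (hA : IsHadamardMatrix A) {m : ℕ} (hm : h = 2 * m) (h0 : 0 < h) :
    ∑ b, schurEntry A b b = (h : ℝ) * Nat.centralBinom m := by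
  have habs : ∀ b k, correlationSign A b k * correlation A b k = |correlation A b k| := by
    intro b k
    unfold correlationSign
    split_ifs with hc
    · rw [abs_of_nonneg hc, one_mul]
    · rw [abs_of_neg (not_le.1 hc)]; ring
  have hp : (0 : ℝ) < h := by positivity
  unfold schurEntry
  simp only [habs]
  rw [← Finset.mul_sum, Finset.sum_comm]
  have : ∀ k, ∑ b : Finset (Fin h), |correlation A b k| = h * Nat.centralBinom m := by
    intro k
    have := sum_signVec_twist (fun l => A l k) (fun l => hA.1 l k) (fun x => |x|)
    unfold correlation
    rw [this]
    subst hm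
    rw [sum_abs_sum_signVec]; push_cast; ring
  simp only [this, Finset.sum_const, Finset.card_univ, Fintype.card_fin, nsmul_eq_mul]
  field_simp

lemma sum_schurEntry_sq (hA : IsHadamardMatrix A) (h0 : 0 < h) (b : Finset (Fin h)) :
    ∑ b', schurEntry A b b' ^ 2 = Fintype.card (Finset (Fin h)) := by
  have hp : (0 : ℝ) < h := by positivity
  have hre : ∀ b', schurEntry A b b'
      = (h : ℝ)⁻¹ * ∑ l, (∑ k, A.transpose k l * correlationSign A b k) * signVec b' l := by
    intro b'
    unfold schurEntry correlation
    congr 1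
    simp only [Finset.mul_sum, Finset.sum_mul, Matrix.transpose_apply]
    rw [Finset.sum_comm]
    refine Finset.sum_congr rfl fun l _ => Finset.sum_congr rfl fun k _ => ?_
    ring
  simp only [hre, mul_pow]
  have hT : A.transpose * A.transpose.transpose = (h : ℝ) • 1 := by
    rw [Matrix.transpose_transpose, hA.transpose_mul h0]
  rw [← Finset.mul_sum, sum_sq_sum_mul_signVec, sum_sq_vecMul_of_mul_transpose hT,
    sum_correlationSign_sq]
  field_simp

end Border

/-- Averaging over one coordinate of a product space. -/
lemma sum_pi_eq_of_sum_eq_card {κ β : Type*} [Fintype κ] [DecidableEq κ] [Fintype β]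
    [Nonempty β] (φ : β → β → ℝ) (hφ : ∀ x, ∑ y, φ x y = Fintype.card β)
    {i j : κ} (hij : i ≠ j) :
    ∑ B : κ → β, φ (B i) (B j) = Fintype.card (κ → β) := by
  have inv : Function.Involutive fun p : (κ → β) × β => (Function.update p.1 j p.2, p.1 j) := by
    rintro ⟨B, x⟩
    simp
  have h1 : ∑ p : (κ → β) × β, φ (p.1 i) (p.1 j) = ∑ p : (κ → β) × β, φ (p.1 i) p.2 := by
    rw [← Equiv.sum_comp inv.toPerm]
    refine Finset.sum_congr rfl fun p _ => ?_
    change φ (Function.update p.1 j p.2 i) (Function.update p.1 j p.2 j) = _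
    simp [hij]
  rw [Fintype.sum_prod_type, Fintype.sum_prod_type] at h1
  simp only [hφ, Finset.sum_const, Finset.card_univ, nsmul_eq_mul, ← Finset.mul_sum] at h1
  have hpos : (0 : ℝ) < Fintype.card β := by exact_mod_cast Fintype.card_pos
  rw [mul_comm (Fintype.card (κ → β) : ℝ)] at h1
  exact mul_left_cancel₀ hpos.ne' h1

/-- A product along a nontrivial permutation has at least two off-diagonal factors. -/
lemma abs_prod_perm_le {κ : Type*} [Fintype κ] [DecidableEq κ] (M : Matrix κ κ ℝ) {R : ℝ}
    (hM : ∀ i j, |M i j| ≤ R) (σ : Equiv.Perm κ) {i : κ} (hi : σ i ≠ i) :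
    |∏ k, M (σ k) k| ≤
      (M (σ i) i ^ 2 + M (σ (σ i)) (σ i) ^ 2) / 2 * R ^ (Fintype.card κ - 2) := by
  have hR : 0 ≤ R := (abs_nonneg _).trans (hM i i)
  rw [Finset.abs_prod, ← Finset.mul_prod_erase _ _ (Finset.mem_univ i),
    ← Finset.mul_prod_erase _ _ (Finset.mem_erase.2 ⟨hi, Finset.mem_univ (σ i)⟩), ← mul_assoc]
  gcongr
  · rw [← sq_abs (M (σ i) i), ← sq_abs (M (σ (σ i)) (σ i))]
    nlinarith [sq_nonneg (|M (σ i) i| - |M (σ (σ i)) (σ i)|)]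
  · have hc : #((univ.erase i).erase (σ i)) = Fintype.card κ - 2 := by
      rw [Finset.card_erase_of_mem (Finset.mem_erase.2 ⟨hi, Finset.mem_univ _⟩),
        Finset.card_erase_of_mem (Finset.mem_univ _), Finset.card_univ]; omega
    rw [← hc, ← Finset.prod_const]
    exact Finset.prod_le_prod (fun _ _ => abs_nonneg _) fun k _ => hM _ _

/-- The expected determinant of the identity plus a random matrix whose entries
are given by a kernel with unit second moments. -/
lemma le_sum_det_one_add {β : Type*} [Fintype β] [Nonempty β] (d : ℕ) (φ : β → β → ℝ) {R g : ℝ}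
    (hR : ∀ x y, |φ x y| ≤ R) (hφ : ∀ x, ∑ y, φ x y ^ 2 = Fintype.card β)
    (hg : ∑ x, φ x x = Fintype.card β * g) :
    (Fintype.card (Fin d → β) : ℝ) *
        ((1 + g) ^ d - ((d.factorial : ℝ) - 1) * (1 + R) ^ (d - 2))
      ≤ ∑ B : Fin d → β, (1 + Matrix.of fun i j => φ (B i) (B j)).det := by
  simp only [Matrix.det_apply]
  rw [Finset.sum_comm, ← Finset.add_sum_erase _ _ (Finset.mem_univ (1 : Equiv.Perm (Fin d)))]
  have hid : ∑ B : Fin d → β, Equiv.Perm.sign (1 : Equiv.Perm (Fin d)) •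
      ∏ i, ((1 : Matrix (Fin d) (Fin d) ℝ) + Matrix.of fun i j => φ (B i) (B j))
        ((1 : Equiv.Perm (Fin d)) i) i = (Fintype.card (Fin d → β) : ℝ) * (1 + g) ^ d := by
    simp only [Equiv.Perm.sign_one, one_smul, Equiv.Perm.one_apply, Matrix.add_apply,
      Matrix.one_apply_eq, Matrix.of_apply]
    have := Finset.prod_univ_sum (fun _ : Fin d => (univ : Finset β))
      (fun _ x => (1 + φ x x : ℝ))
    rw [Fintype.piFinset_univ] at this
    rw [← this, Finset.sum_add_distrib, hg]
    simp only [Finset.sum_const, Finset.card_univ, nsmul_eq_mul, mul_one, Finset.prod_const,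
      Fintype.card_fin, Fintype.card_fun, Nat.cast_pow]
    rw [← mul_pow]; ring
  have hother : ∀ σ ∈ (univ : Finset (Equiv.Perm (Fin d))).erase 1,
      -((Fintype.card (Fin d → β) : ℝ) * (1 + R) ^ (d - 2)) ≤
      ∑ B : Fin d → β, Equiv.Perm.sign σ •
      ∏ i, ((1 : Matrix (Fin d) (Fin d) ℝ) + Matrix.of fun i j => φ (B i) (B j)) (σ i) i := by
    intro σ hσ
    obtain ⟨i, hi⟩ : ∃ i, σ i ≠ i := by
      by_contra! hc
      exact (Finset.mem_erase.1 hσ).1 (Equiv.ext hc)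
    have hi' : σ (σ i) ≠ σ i := fun hc => hi (σ.injective hc)
    have hb : ∀ B : Fin d → β, -((φ (B (σ i)) (B i) ^ 2 + φ (B (σ (σ i))) (B (σ i)) ^ 2) / 2
        * (1 + R) ^ (d - 2)) ≤ Equiv.Perm.sign σ •
      ∏ i, ((1 : Matrix (Fin d) (Fin d) ℝ) + Matrix.of fun i j => φ (B i) (B j)) (σ i) i := by
      intro B
      have h1 := abs_prod_perm_le
        ((1 : Matrix (Fin d) (Fin d) ℝ) + Matrix.of fun i j => φ (B i) (B j)) (R := 1 + R)
        (fun i j => by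
          refine (abs_add_le _ _).trans (add_le_add ?_ (hR _ _))
          by_cases hij : i = j <;> simp [Matrix.one_apply, hij]) σ hi
      simp only [Matrix.add_apply, Matrix.one_apply_ne hi, Matrix.one_apply_ne hi', zero_add,
        Matrix.of_apply, Fintype.card_fin] at h1
      have h2 := abs_le.1 h1
      simp only [Matrix.add_apply, Matrix.of_apply]
      rcases Int.units_eq_one_or (Equiv.Perm.sign σ) with hs | hs
      · rw [hs, one_smul]; exact h2.1
      · rw [hs, Units.neg_smul, one_smul]; exact neg_le_neg h2.2
    refine le_trans (le_of_eq ?_) (Finset.sum_le_sum fun B _ => hb B)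
    rw [Finset.sum_neg_distrib, ← Finset.sum_mul, ← Finset.sum_div, Finset.sum_add_distrib,
      sum_pi_eq_of_sum_eq_card (fun x y => φ x y ^ 2) hφ hi,
      sum_pi_eq_of_sum_eq_card (fun x y => φ x y ^ 2) hφ hi']
    ring
  have hs := Finset.card_nsmul_le_sum _ _ _ hother
  rw [hid]
  rw [Finset.card_erase_of_mem (Finset.mem_univ _), Finset.card_univ, Fintype.card_perm,
    Fintype.card_fin, nsmul_eq_mul, Nat.cast_sub (Nat.factorial_pos d), Nat.cast_one] at hs
  linarith

/-- A lower bound for the maximal determinant at orders exceeding a Hadamard order. -/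
lemma IsHadamardOrder.le_maxDet {h : ℕ} (hH : IsHadamardOrder h) (d : ℕ) (h2 : 2 ≤ h) :
    ∃ g : ℝ, 0 ≤ g ∧ 2 * (h : ℝ) ^ 2 ≤ Real.pi * (h + 1) * g ^ 2 ∧
      (h : ℝ) ^ ((h : ℝ) / 2) * ((1 + g) ^ d - ((d.factorial : ℝ) - 1) * (1 + √h) ^ (d - 2))
        ≤ maxDet (h + d) := by
  obtain ⟨A, hA⟩ := hH
  have h0 : 0 < h := by omega
  obtain ⟨m, hm⟩ := hA.even_of_two_le h2
  rw [← two_mul] at hm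
  have hcard : (Fintype.card (Finset (Fin h)) : ℝ) = 4 ^ m := by
    rw [Fintype.card_finset, Fintype.card_fin, hm, pow_mul]; norm_num
  have h4 : (0 : ℝ) < 4 ^ m := by positivity
  refine ⟨h * Nat.centralBinom m / 4 ^ m, by positivity, ?_, ?_⟩
  · have := sq_four_pow_le_centralBinom m
    have hh : (h : ℝ) = 2 * m := by exact_mod_cast hm
    rw [div_pow, mul_pow, ← mul_div_assoc, le_div_iff₀ (by positivity)]
    calc 2 * (h : ℝ) ^ 2 * ((4 : ℝ) ^ m) ^ 2
        ≤ 2 * (h : ℝ) ^ 2 * (Real.pi / 2 * (2 * m + 1) * (Nat.centralBinom m : ℝ) ^ 2) := by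
          gcongr
      _ = _ := by rw [← hh]; ring
  · have hsum := le_sum_det_one_add d (schurEntry A) (abs_schurEntry_le hA h0)
      (sum_schurEntry_sq hA h0) (g := h * Nat.centralBinom m / 4 ^ m)
      (by rw [sum_schurEntry_self hA hm h0, hcard]; field_simp)
    rw [← nsmul_eq_mul, ← Finset.card_univ, ← Finset.sum_const] at hsum
    obtain ⟨B, -, hB⟩ := Finset.exists_le_of_sum_le Finset.univ_nonempty hsum
    refine le_trans ?_ (mul_det_le_maxDet h0 hA (Matrix.of fun l j => signVec (B j) l)
      (fun l j => signVec_eq _ _) (Matrix.of fun i k => correlationSign A (B i) k)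
      (fun i k => correlationSign_eq _ _ _))
    gcongr
    refine hB.trans (le_of_eq ?_)
    congr 2

lemma one_add_div_pow_le {s : ℝ} {d : ℕ} (h1 : 1 ≤ d) (hs : 3 * (d : ℝ) ≤ s) :
    (1 + 1 / s) ^ d ≤ 3 / 2 := by
  have hd : (1 : ℝ) ≤ d := by exact_mod_cast h1
  have hs0 : 0 < s := by linarith
  have hb := one_add_mul_le_pow (a := -(1 / s))
    (by have : 1 / s ≤ 1 := by rw [div_le_one hs0]; linarith
        linarith) d
  have hds : (d : ℝ) * (1 / s) ≤ 1 / 3 := by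
    rw [mul_one_div, div_le_div_iff₀ hs0 (by norm_num)]; linarith
  have hprod : (1 + 1 / s) ^ d * (1 + -(1 / s)) ^ d ≤ 1 := by
    rw [← mul_pow]
    apply pow_le_one₀
    · have : 1 / s ≤ 1 := by rw [div_le_one hs0]; linarith
      have : 0 ≤ 1 / s := by positivity
      apply mul_nonneg <;> linarith
    · nlinarith [sq_nonneg (1 / s)]
  have hp : 0 < (1 + 1 / s) ^ d := by positivity
  nlinarith

lemma mul_sub_le_pow_sub_pow {x y : ℝ} (hy : 1 ≤ y) (hxy : y ≤ x) (d : ℕ) :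
    (d : ℝ) * (x - y) ≤ x ^ d - y ^ d := by
  induction d with
  | zero => simp
  | succ d ih =>
    have h1 : 1 ≤ y ^ d := one_le_pow₀ hy
    have h2 : y ^ d ≤ x ^ d := by gcongr
    push_cast
    rw [pow_succ, pow_succ]
    nlinarith [mul_nonneg (sub_nonneg.2 h2) (by linarith : (0 : ℝ) ≤ y - 1),
      mul_nonneg (sub_nonneg.2 hxy) (by linarith : (0 : ℝ) ≤ x ^ d - 1)]

/-- The off-diagonal contributions are small compared with the main term. -/
lemma factorial_mul_pow_le {a s : ℝ} {d : ℕ} (h1 : 1 ≤ d) (ha : 0 < a)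
    (ha1 : a ≤ 4 / 5)
    (hs : Real.exp 1 * (1 / a) ^ d * ((d - 1).factorial : ℝ) + d ≤ s) :
    ((d.factorial : ℝ) - 1) * (1 + s) ^ (d - 2) ≤ (a * s) ^ d * (d * (3 / 5 / s)) := by
  have hd : (1 : ℝ) ≤ d := by exact_mod_cast h1
  have he : (2.718 : ℝ) < Real.exp 1 := lt_trans (by norm_num) Real.exp_one_gt_d9
  have hinv : 5 / 4 ≤ 1 / a := by rw [le_div_iff₀ ha]; linarith
  have hs0 : 0 < s := by
    have : 0 ≤ Real.exp 1 * (1 / a) ^ d * ((d - 1).factorial : ℝ) := by positivity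
    linarith
  rcases Nat.lt_or_ge d 2 with hd2 | hd2
  · obtain rfl : d = 1 := by omega
    simp; positivity
  · have hd2' : (2 : ℝ) ≤ d := by exact_mod_cast hd2
    have hfac : (d : ℝ) - 1 ≤ ((d - 1).factorial : ℝ) := by
      have := Nat.self_le_factorial (d - 1)
      have h' : ((d - 1 : ℕ) : ℝ) ≤ ((d - 1).factorial : ℝ) := by exact_mod_cast this
      rwa [Nat.cast_sub h1, Nat.cast_one] at h'
    have hpow : 25 / 16 ≤ (1 / a) ^ d := by
      calc (25 / 16 : ℝ) = (5 / 4) ^ 2 := by norm_num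
        _ ≤ (5 / 4) ^ d := pow_le_pow_right₀ (by norm_num) hd2
        _ ≤ _ := by gcongr
    have h3 : 3 * (d : ℝ) ≤ s := by
      have : 2.718 * (25 / 16) * ((d : ℝ) - 1)
          ≤ Real.exp 1 * (1 / a) ^ d * ((d - 1).factorial : ℝ) := by
        have : (0 : ℝ) ≤ (d : ℝ) - 1 := by linarith
        gcongr
      linarith
    have hb := one_add_div_pow_le h1 h3
    have hb' : (1 + 1 / s) ^ (d - 2) ≤ 3 / 2 := by
      refine le_trans (pow_le_pow_right₀ ?_ (Nat.sub_le d 2)) hb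
      have : 0 ≤ 1 / s := by positivity
      linarith
    have hspow : (1 + s) ^ (d - 2) = s ^ (d - 2) * (1 + 1 / s) ^ (d - 2) := by
      rw [← mul_pow]; congr 1; field_simp; ring
    have hdf : (d.factorial : ℝ) = d * (d - 1).factorial := by
      exact_mod_cast (Nat.mul_factorial_pred (by omega)).symm
    have hK : ((d - 1).factorial : ℝ) ≤ 2 / 5 * (a ^ d * s) := by
      have h5 : Real.exp 1 * (1 / a) ^ d * ((d - 1).factorial : ℝ) ≤ s := by linarith
      have h6 : Real.exp 1 * ((d - 1).factorial : ℝ) ≤ a ^ d * s := by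
        calc Real.exp 1 * ((d - 1).factorial : ℝ)
            = a ^ d * (Real.exp 1 * (1 / a) ^ d * ((d - 1).factorial : ℝ)) := by
              rw [one_div, inv_pow]; field_simp
          _ ≤ _ := by gcongr
      have h7 : (0 : ℝ) < ((d - 1).factorial : ℝ) := by positivity
      nlinarith
    calc ((d.factorial : ℝ) - 1) * (1 + s) ^ (d - 2)
        ≤ (d.factorial : ℝ) * (1 + s) ^ (d - 2) := by gcongr; linarith
      _ = d * (d - 1).factorial * (s ^ (d - 2) * (1 + 1 / s) ^ (d - 2)) := by rw [hspow, hdf]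
      _ ≤ d * (2 / 5 * (a ^ d * s)) * (s ^ (d - 2) * (3 / 2)) := by gcongr
      _ = (a * s) ^ d * (d * (3 / 5 / s)) := by
        obtain ⟨k, rfl⟩ := Nat.exists_eq_add_of_le hd2
        rw [Nat.add_sub_cancel_left]
        field_simp
        ring

lemma pow_le_expected_det {a s g : ℝ} {d : ℕ} (h1 : 1 ≤ d) (ha : 0 < a)
    (ha1 : a ≤ 4 / 5) (hg : 0 ≤ g) (hgs : a ^ 2 * s ^ 4 ≤ (s ^ 2 + 1) * g ^ 2)
    (hs : Real.exp 1 * (1 / a) ^ d * ((d - 1).factorial : ℝ) + d ≤ s) :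
    (a * √(s ^ 2 + d)) ^ d
      ≤ (1 + g) ^ d - ((d.factorial : ℝ) - 1) * (1 + s) ^ (d - 2) := by
  have hd : (1 : ℝ) ≤ d := by exact_mod_cast h1
  have he : (2.718 : ℝ) < Real.exp 1 := lt_trans (by norm_num) Real.exp_one_gt_d9
  have hinv : 5 / 4 ≤ 1 / a := by rw [le_div_iff₀ ha]; linarith
  have hterm : 2.718 * (5 / 4) * 1 ≤ Real.exp 1 * (1 / a) ^ d * ((d - 1).factorial : ℝ) := by
    have hf : (1 : ℝ) ≤ ((d - 1).factorial : ℝ) := by exact_mod_cast Nat.factorial_pos _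
    have hpow : 5 / 4 ≤ (1 / a) ^ d := hinv.trans (le_self_pow₀ (by linarith) (by omega))
    gcongr
  have hs4 : 4 ≤ s := by linarith
  have hds : (d : ℝ) ≤ s := by linarith
  have hs0 : 0 < s := by linarith
  have hsq : √(s ^ 2 + d) ≤ s * (1 + 1 / 2 / s) := by
    have : s * (1 + 1 / 2 / s) = s + 1 / 2 := by field_simp
    rw [this]
    apply Real.sqrt_le_iff.2
    constructor <;> nlinarith
  have hglow : a * (s - 1 / (2 * s)) ≤ g := by
    refine le_of_sq_le_sq ?_ hg
    have hpos : 0 < s ^ 2 + 1 := by positivity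
    refine le_of_mul_le_mul_left (le_trans ?_ hgs) hpos
    have e : (s ^ 2 + 1) * (a * (s - 1 / (2 * s))) ^ 2
        = a ^ 2 * s ^ 4 - a ^ 2 * (3 / 4 - 1 / (4 * s ^ 2)) := by
      field_simp; ring
    rw [e]
    have : 1 / (4 * s ^ 2) ≤ 3 / 4 := by
      rw [div_le_div_iff₀ (by positivity) (by norm_num)]; nlinarith
    nlinarith [mul_nonneg (sq_nonneg a) (sub_nonneg.2 this)]
  have hg1 : a * s * (1 + 11 / 10 / s) ≤ 1 + g := by
    have e : a * s * (1 + 11 / 10 / s) = a * s + 11 / 10 * a := by field_simp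
    have e2 : 1 / (2 * s) ≤ 1 / 8 := by
      rw [div_le_div_iff₀ (by positivity) (by norm_num)]; linarith
    rw [e]; nlinarith
  have hx : (d : ℝ) * (3 / 5 / s) ≤ (1 + 11 / 10 / s) ^ d - (1 + 1 / 2 / s) ^ d := by
    have := mul_sub_le_pow_sub_pow (x := 1 + 11 / 10 / s) (y := 1 + 1 / 2 / s)
      (by have : 0 ≤ 1 / 2 / s := by positivity
          linarith) 
      (by linarith [div_le_div_of_nonneg_right (by norm_num : (1 / 2 : ℝ) ≤ 11 / 10) hs0.le]) d
    refine le_trans (le_of_eq ?_) this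
    ring
  have hoff := factorial_mul_pow_le h1 ha ha1 hs
  have hA : (a * √(s ^ 2 + d)) ^ d ≤ (a * s) ^ d * (1 + 1 / 2 / s) ^ d := by
    rw [← mul_pow, mul_assoc]; gcongr
  have hB : (a * s) ^ d * (1 + 11 / 10 / s) ^ d ≤ (1 + g) ^ d := by
    rw [← mul_pow]; gcongr
  have hC := mul_le_mul_of_nonneg_left hx (by positivity : 0 ≤ (a * s) ^ d)
  rw [mul_sub] at hC
  linarith

lemma add_rpow_lt {h d : ℝ} (hh : 0 < h) (hd : 0 < d) :
    (h + d) ^ (h / 2) < h ^ (h / 2) * Real.exp 1 ^ (d / 2) := by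
  have h1 : 1 + d / h < Real.exp (d / h) := by
    rw [add_comm]; exact Real.add_one_lt_exp (by positivity)
  have h2 : h + d = h * (1 + d / h) := by field_simp
  rw [h2, Real.mul_rpow hh.le (by positivity)]
  have h3 : (1 + d / h) ^ (h / 2) < Real.exp (d / h) ^ (h / 2) :=
    Real.rpow_lt_rpow (by positivity) h1 (by positivity)
  rw [← Real.exp_mul] at h3
  rw [← Real.exp_mul]
  have h4 : d / h * (h / 2) = 1 * (d / 2) := by field_simp
  rw [h4] at h3
  gcongr

theorem maxDetBar_lower_bound_large_h (d h n : ℕ) (hd : 1 ≤ d)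
    (hH : IsHadamardOrder h)
    (hh : (h : ℝ) ≥
      (Real.exp 1 * (Real.pi / 2) ^ ((d : ℝ) / 2) * (Nat.factorial (d - 1) : ℝ)
        + (d : ℝ)) ^ 2)
    (hn : n = h + d) :
    maxDetBar n > (2 / (Real.pi * Real.exp 1)) ^ ((d : ℝ) / 2) := by
  subst hn
  have hd1 : (1 : ℝ) ≤ d := by exact_mod_cast hd
  have hpi := Real.pi_pos
  have half_pow : ∀ x : ℝ, 0 ≤ x → x ^ ((d : ℝ) / 2) = √x ^ d := fun x hx => by
    rw [Real.sqrt_eq_rpow, ← Real.rpow_natCast, ← Real.rpow_mul hx]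
    congr 1; ring
  have he : (2.718 : ℝ) < Real.exp 1 := lt_trans (by norm_num) Real.exp_one_gt_d9
  have hs : Real.exp 1 * (1 / √(2 / Real.pi)) ^ d * ((d - 1).factorial : ℝ) + d ≤ √h := by
    apply Real.le_sqrt_of_sq_le
    rw [half_pow _ (by positivity)] at hh
    rwa [one_div, ← Real.sqrt_inv, inv_div]
  have h2 : 2 ≤ h := by
    have h0 : 0 ≤ Real.exp 1 * (Real.pi / 2) ^ ((d : ℝ) / 2) * (Nat.factorial (d - 1) : ℝ) := by
      positivity
    have hb : 1 ≤ (Real.pi / 2) ^ ((d : ℝ) / 2) :=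
      Real.one_le_rpow (by linarith [Real.pi_gt_three]) (by positivity)
    have hf : (1 : ℝ) ≤ ((d - 1).factorial : ℝ) := by exact_mod_cast Nat.factorial_pos _
    have : 2.718 * 1 * 1
        ≤ Real.exp 1 * (Real.pi / 2) ^ ((d : ℝ) / 2) * (Nat.factorial (d - 1) : ℝ) := by
      gcongr
    have : (2 : ℝ) ≤ h := by nlinarith
    exact_mod_cast this
  obtain ⟨g, hg, hgh, hD⟩ := hH.le_maxDet d h2
  have hpos : (0 : ℝ) < h := by positivity
  have hsq : √(h : ℝ) ^ 2 = h := Real.sq_sqrt hpos.le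
  have hdet := pow_le_expected_det (a := √(2 / Real.pi)) (s := √h) (g := g) hd
    (by positivity)
    (by apply Real.sqrt_le_iff.2
        refine ⟨by norm_num, ?_⟩
        rw [div_le_iff₀ hpi]; nlinarith [Real.pi_gt_d4])
    hg
    (by rw [Real.sq_sqrt (by positivity), show √(h : ℝ) ^ 4 = (√(h : ℝ) ^ 2) ^ 2 by ring, hsq,
          div_mul_eq_mul_div, div_le_iff₀ hpi]
        linarith)
    hs
  rw [hsq, mul_pow, ← half_pow _ (by positivity), ← half_pow _ (by positivity)] at hdet
  have hmain := (mul_le_mul_of_nonneg_left hdet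
    (by positivity : (0 : ℝ) ≤ (h : ℝ) ^ ((h : ℝ) / 2))).trans hD
  have hlt := add_rpow_lt hpos (by linarith : (0 : ℝ) < d)
  unfold maxDetBar
  rw [gt_iff_lt, lt_div_iff₀ (by positivity)]
  refine lt_of_lt_of_le ?_ hmain
  have hsplit : ((h + d : ℕ) : ℝ) ^ (((h + d : ℕ) : ℝ) / 2)
      = ((h : ℝ) + d) ^ ((h : ℝ) / 2) * ((h : ℝ) + d) ^ ((d : ℝ) / 2) := by
    rw [← Real.rpow_add (by positivity)]; push_cast; congr 1; ring
  have hquot : (2 / (Real.pi * Real.exp 1)) ^ ((d : ℝ) / 2)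
      = (2 / Real.pi) ^ ((d : ℝ) / 2) / Real.exp 1 ^ ((d : ℝ) / 2) := by
    rw [← Real.div_rpow (by positivity) (by positivity), div_div]
  have hE : 0 < Real.exp 1 ^ ((d : ℝ) / 2) := by positivity
  rw [hsplit, hquot]
  calc (2 / Real.pi) ^ ((d : ℝ) / 2) / Real.exp 1 ^ ((d : ℝ) / 2)
        * (((h : ℝ) + d) ^ ((h : ℝ) / 2) * ((h : ℝ) + d) ^ ((d : ℝ) / 2))
      < (2 / Real.pi) ^ ((d : ℝ) / 2) / Real.exp 1 ^ ((d : ℝ) / 2)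
        * (((h : ℝ) ^ ((h : ℝ) / 2) * Real.exp 1 ^ ((d : ℝ) / 2))
          * ((h : ℝ) + d) ^ ((d : ℝ) / 2)) := by gcongr
    _ = _ := by field_simp
end

section
/- For each integer d ≥ 0 there exists a positive constant κ_d > 0 such that for every integer h ≥ 4 that is the order of a Hadamard matrix, the integer n = h + d satisfies D̄(n) ≥ κ_d. -/
/-- The linear form `∑ i, ± a i` whose signs are given by `e`. -/
noncomputable def signSum {n : ℕ} (a : Fin n → ℝ) (e : Fin n → Bool) : ℝ :=
  ∑ i, a i * (if e i then 1 else -1)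

lemma sum_signs_succ {n : ℕ} (a : Fin (n + 1) → ℝ) (f : ℝ → ℝ) :
    ∑ e, f (signSum a e) =
      ∑ e, (f (a 0 + signSum (fun i => a i.succ) e) + f (-a 0 + signSum (fun i => a i.succ) e)) := by
  rw [← (Fin.consEquiv (fun _ : Fin (n + 1) => Bool)).sum_comp, Fintype.sum_prod_type,
    Fintype.sum_bool, ← Finset.sum_add_distrib]
  simp [signSum, Fin.sum_univ_succ, Fin.consEquiv]

lemma sum_signSum_sq {n : ℕ} (a : Fin n → ℝ) :
    ∑ e, signSum a e ^ 2 = 2 ^ n * ∑ i, a i ^ 2 := by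
  induction n with
  | zero => simp [signSum]
  | succ n ih =>
    rw [sum_signs_succ a (fun x => x ^ 2), Fin.sum_univ_succ]
    have h (x : ℝ) : (a 0 + x) ^ 2 + (-a 0 + x) ^ 2 = 2 * a 0 ^ 2 + 2 * x ^ 2 := by ring
    simp only [h, Finset.sum_add_distrib, ← Finset.mul_sum, ih]
    simp
    ring

lemma sum_signSum_pow_four_le {n : ℕ} (a : Fin n → ℝ) :
    ∑ e, signSum a e ^ 4 ≤ 2 ^ n * (3 * (∑ i, a i ^ 2) ^ 2) := by
  induction n with
  | zero => simp [signSum]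
  | succ n ih =>
    rw [sum_signs_succ a (fun x => x ^ 4), Fin.sum_univ_succ]
    have h (x : ℝ) : (a 0 + x) ^ 4 + (-a 0 + x) ^ 4 =
        2 * a 0 ^ 4 + (12 * a 0 ^ 2) * x ^ 2 + 2 * x ^ 4 := by ring
    simp only [h, Finset.sum_add_distrib, ← Finset.mul_sum, sum_signSum_sq]
    have := ih (fun i => a i.succ)
    have h4 : 0 ≤ (2 : ℝ) ^ n * a 0 ^ 4 := by positivity
    simp only [Finset.sum_const, Finset.card_univ, Fintype.card_pi, Fintype.card_bool,
      Finset.prod_const, Fintype.card_fin, nsmul_eq_mul]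
    push_cast
    rw [pow_succ (2 : ℝ) n]
    nlinarith

/-- Khinchine's inequality in `L¹`, with constant `5 / 9`. -/
lemma sum_abs_signSum_ge {n : ℕ} (a : Fin n → ℝ) :
    2 ^ n * (5 / 9 * √(∑ i, a i ^ 2)) ≤ ∑ e, |signSum a e| := by
  have hV : 0 ≤ ∑ i, a i ^ 2 := Finset.sum_nonneg fun i _ => sq_nonneg _
  set s := √(∑ i, a i ^ 2) with hs
  have hs2 : ∑ i, a i ^ 2 = s ^ 2 := (Real.sq_sqrt hV).symm
  rcases (Real.sqrt_nonneg (∑ i, a i ^ 2)).eq_or_lt with h0 | hpos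
  · rw [hs, ← h0]
    simpa using Finset.sum_nonneg fun e _ => abs_nonneg (signSum a e)
  have hpos : 0 < s := hpos
  have key (x : ℝ) : s ^ 2 * x ^ 2 - 4 / 27 * x ^ 4 ≤ s ^ 3 * |x| := by
    have h2 : x ^ 2 = |x| ^ 2 := (sq_abs x).symm
    have h4 : x ^ 4 = |x| ^ 4 := by rw [show x ^ 4 = (x ^ 2) ^ 2 by ring, h2]; ring
    rw [h2, h4]
    have ht : 0 ≤ |x| := abs_nonneg x
    have : 0 ≤ |x| * ((|x| / 3 + s) * (2 * |x| / 3 - s) ^ 2) := by positivity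
    nlinarith
  have hsum := Finset.sum_le_sum fun e (_ : e ∈ (Finset.univ : Finset (Fin n → Bool))) =>
    key (signSum a e)
  rw [Finset.sum_sub_distrib, ← Finset.mul_sum, ← Finset.mul_sum, ← Finset.mul_sum,
    sum_signSum_sq, hs2] at hsum
  have h4 := sum_signSum_pow_four_le a
  rw [hs2] at h4
  refine le_of_mul_le_mul_left ?_ (pow_pos hpos 3)
  nlinarith

lemma finite_abs_det_signMatrix (n : ℕ) :
    {x : ℝ | ∃ M : Matrix (Fin n) (Fin n) ℝ,
      (∀ i j, M i j = 1 ∨ M i j = -1) ∧ x = |M.det|}.Finite := by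
  have hf : {M : Matrix (Fin n) (Fin n) ℝ | ∀ i j, M i j = 1 ∨ M i j = -1}.Finite := by
    have := Set.Finite.pi' (fun _ : Fin n => Set.Finite.pi' (fun _ : Fin n =>
      Set.toFinite ({1, -1} : Set ℝ)))
    exact this.subset fun M hM i j => by simpa using hM i j
  refine (hf.image fun M => |M.det|).subset ?_
  rintro x ⟨M, hM, rfl⟩
  exact ⟨M, hM, rfl⟩

lemma abs_det_le_maxDet {n : ℕ} (M : Matrix (Fin n) (Fin n) ℝ)
    (hM : ∀ i j, M i j = 1 ∨ M i j = -1) : |M.det| ≤ maxDet n :=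
  le_csSup (finite_abs_det_signMatrix n).bddAbove ⟨M, hM, rfl⟩

lemma exists_abs_det_eq_maxDet (n : ℕ) :
    ∃ M : Matrix (Fin n) (Fin n) ℝ, (∀ i j, M i j = 1 ∨ M i j = -1) ∧ maxDet n = |M.det| :=
  have hne : {x : ℝ | ∃ M : Matrix (Fin n) (Fin n) ℝ,
      (∀ i j, M i j = 1 ∨ M i j = -1) ∧ x = |M.det|}.Nonempty :=
    ⟨_, fun _ _ => 1, fun _ _ => Or.inl rfl, rfl⟩
  hne.csSup_mem (finite_abs_det_signMatrix n)

/-- Bordering a sign matrix by a column `b`, a row `c` and a corner entry `-1`. -/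
lemma abs_det_mul_le_maxDet_succ {n : ℕ} (M : Matrix (Fin n) (Fin n) ℝ)
    (hM : ∀ i j, M i j = 1 ∨ M i j = -1) (hdet : M.det ≠ 0) (b c : Fin n → ℝ)
    (hb : ∀ i, b i = 1 ∨ b i = -1) (hc : ∀ i, c i = 1 ∨ c i = -1) :
    |M.det| * |-1 - c ⬝ᵥ (M⁻¹.mulVec b)| ≤ maxDet (n + 1) := by
  let _ : Invertible M := M.invertibleOfIsUnitDet hdet.isUnit
  have hN : (Matrix.fromBlocks M (Matrix.of fun i (_ : Fin 1) => b i)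
      (Matrix.of fun (_ : Fin 1) j => c j) (Matrix.of fun _ _ => -1)).det = M.det * (-1 - c ⬝ᵥ (M⁻¹.mulVec b)) := by
    rw [Matrix.det_fromBlocks₁₁, Matrix.invOf_eq_nonsing_inv, Matrix.det_fin_one, Matrix.mul_assoc]
    rfl
  rw [← abs_mul, ← hN, ← Matrix.det_submatrix_equiv_self finSumFinEquiv.symm]
  refine abs_det_le_maxDet _ fun i j => ?_
  rw [Matrix.submatrix_apply]
  rcases finSumFinEquiv.symm i with i | i <;> rcases finSumFinEquiv.symm j with j | j
  · exact hM i j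
  · exact hb i
  · exact hc j
  · exact Or.inr rfl

lemma inv_sqrt_le_norm_inv_row {n : ℕ} (M : Matrix (Fin n) (Fin n) ℝ)
    (hM : ∀ i j, M i j = 1 ∨ M i j = -1) (hdet : M.det ≠ 0) (i : Fin n) :
    1 / √n ≤ √(∑ j, M⁻¹ i j ^ 2) := by
  have h1 : ∑ j, M⁻¹ i j * M j i = 1 := by
    rw [← Matrix.mul_apply, Matrix.nonsing_inv_mul M hdet.isUnit, Matrix.one_apply_eq]
  have h2 : ∑ j, M j i ^ 2 = n := by
    have (j : Fin n) : M j i ^ 2 = 1 := by rcases hM j i with h | h <;> simp [h]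
    simp [this]
  have hcs := Finset.sum_mul_sq_le_sq_mul_sq Finset.univ (fun j => M⁻¹ i j) (fun j => M j i)
  rw [h1, h2] at hcs
  have hn : 0 < (n : ℝ) := Nat.cast_pos.mpr i.pos
  rw [← Real.sqrt_one, ← Real.sqrt_div zero_le_one]
  refine Real.sqrt_le_sqrt ?_
  rw [div_le_iff₀ hn]
  linarith

/-- Each sign matrix can be bordered so that its determinant grows by a factor of order `√n`. -/
lemma maxDet_succ_ge (n : ℕ) : maxDet n * (5 / 9 * √n) ≤ maxDet (n + 1) := by
  obtain ⟨M, hM, hmax⟩ := exists_abs_det_eq_maxDet n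
  rw [hmax]
  by_cases hdet : M.det = 0
  · obtain ⟨N, -, hN⟩ := exists_abs_det_eq_maxDet (n + 1)
    rw [hdet, hN]
    simp
  have hsum : ∑ _e : Fin n → Bool, 5 / 9 * √(n : ℝ) ≤ ∑ e, ∑ i, |signSum (M⁻¹ i) e| := by
    rw [Finset.sum_comm]
    calc ∑ _e : Fin n → Bool, 5 / 9 * √(n : ℝ)
        = ∑ _i : Fin n, 2 ^ n * (5 / 9 * (1 / √n)) := by
          simp only [Finset.sum_const, Finset.card_univ, Fintype.card_pi, Fintype.card_bool,
            Finset.prod_const, Fintype.card_fin, nsmul_eq_mul]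
          have hsqrt : (n : ℝ) * (1 / √n) = √n := by rw [mul_one_div, Real.div_sqrt]
          push_cast
          linear_combination -(2 ^ n * (5 / 9)) * hsqrt
      _ ≤ _ := Finset.sum_le_sum fun i _ => le_trans
          (by gcongr; exact inv_sqrt_le_norm_inv_row M hM hdet i) (sum_abs_signSum_ge (M⁻¹ i))
  obtain ⟨e, -, he⟩ := Finset.exists_le_of_sum_le Finset.univ_nonempty hsum
  let b : Fin n → ℝ := fun i => if e i then 1 else -1
  let c : Fin n → ℝ := fun i => if 0 ≤ M⁻¹.mulVec b i then 1 else -1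
  have hb (i) : b i = 1 ∨ b i = -1 := by
    by_cases h : e i <;> simp [b, h]
  have hc (i) : c i = 1 ∨ c i = -1 := ite_eq_or_eq _ _ _
  have hcb : c ⬝ᵥ M⁻¹.mulVec b = ∑ i, |signSum (M⁻¹ i) e| := by
    refine Finset.sum_congr rfl fun i _ => ?_
    change (if 0 ≤ signSum (M⁻¹ i) e then (1 : ℝ) else -1) * signSum (M⁻¹ i) e = _
    split_ifs with h
    · rw [abs_of_nonneg h, one_mul]
    · rw [abs_of_neg (not_le.mp h), neg_one_mul]
  refine le_trans ?_ (abs_det_mul_le_maxDet_succ M hM hdet b c hb hc)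
  gcongr
  rw [hcb, abs_sub_comm]
  refine le_trans ?_ (le_abs_self _)
  linarith

lemma succ_rpow_le {n : ℕ} (hn : 0 < n) :
    ((n + 1 : ℕ) : ℝ) ^ (((n + 1 : ℕ) : ℝ) / 2) ≤ 3 * (√n * (n : ℝ) ^ ((n : ℝ) / 2)) := by
  have hn0 : (0 : ℝ) < n := Nat.cast_pos.mpr hn
  have hn1 : (1 : ℝ) ≤ n := Nat.one_le_cast.mpr hn
  have hsplit : ((n + 1 : ℕ) : ℝ) = (1 / n + 1) * n := by
    push_cast
    field_simp
    ring
  have hexp : (1 / (n : ℝ) + 1) ^ (((n + 1 : ℕ) : ℝ) / 2) ≤ 3 := by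
    calc (1 / (n : ℝ) + 1) ^ (((n + 1 : ℕ) : ℝ) / 2)
        ≤ Real.exp (1 / n) ^ (((n + 1 : ℕ) : ℝ) / 2) := by
          gcongr
          exact Real.add_one_le_exp _
      _ = Real.exp (1 / n * (((n + 1 : ℕ) : ℝ) / 2)) := (Real.exp_mul _ _).symm
      _ ≤ Real.exp 1 := by
          gcongr
          push_cast
          rw [one_div_mul_eq_div, div_le_one hn0]
          linarith
      _ ≤ 3 := by linarith [Real.exp_one_lt_d9]
  have hpow : (n : ℝ) ^ (((n + 1 : ℕ) : ℝ) / 2) = √n * (n : ℝ) ^ ((n : ℝ) / 2) := by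
    rw [Real.sqrt_eq_rpow, ← Real.rpow_add hn0]
    congr 1
    push_cast
    ring
  calc ((n + 1 : ℕ) : ℝ) ^ (((n + 1 : ℕ) : ℝ) / 2)
      = ((1 / n + 1) * n) ^ (((n + 1 : ℕ) : ℝ) / 2) := by rw [← hsplit]
    _ = (1 / (n : ℝ) + 1) ^ (((n + 1 : ℕ) : ℝ) / 2) * (n : ℝ) ^ (((n + 1 : ℕ) : ℝ) / 2) :=
        Real.mul_rpow (by positivity) hn0.le
    _ ≤ 3 * (√n * (n : ℝ) ^ ((n : ℝ) / 2)) := by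
        rw [hpow]
        gcongr

lemma maxDetBar_succ_ge {n : ℕ} (hn : 0 < n) :
    5 / 27 * maxDetBar n ≤ maxDetBar (n + 1) := by
  have hn0 : (0 : ℝ) < n := Nat.cast_pos.mpr hn
  have hpos : 0 < (n : ℝ) ^ ((n : ℝ) / 2) := Real.rpow_pos_of_pos hn0 _
  have hD : 0 ≤ maxDet n := by
    obtain ⟨M, -, hM⟩ := exists_abs_det_eq_maxDet n
    rw [hM]
    exact abs_nonneg _
  have hbar : 0 ≤ maxDetBar n := div_nonneg hD hpos.le
  have heq : maxDet n = maxDetBar n * (n : ℝ) ^ ((n : ℝ) / 2) :=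
    (div_mul_cancel₀ _ hpos.ne').symm
  conv_rhs => rw [maxDetBar]
  rw [le_div_iff₀ (by positivity)]
  calc 5 / 27 * maxDetBar n * ((n + 1 : ℕ) : ℝ) ^ (((n + 1 : ℕ) : ℝ) / 2)
      ≤ 5 / 27 * maxDetBar n * (3 * (√n * (n : ℝ) ^ ((n : ℝ) / 2))) := by
        gcongr
        exact succ_rpow_le hn
    _ = maxDet n * (5 / 9 * √n) := by
        rw [heq]
        ring
    _ ≤ maxDet (n + 1) := maxDet_succ_ge n

lemma one_le_maxDetBar {h : ℕ} (h0 : 0 < h) (hh : IsHadamardOrder h) :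
    1 ≤ maxDetBar h := by
  obtain ⟨A, hA, hAA⟩ := hh
  have hpos : (0 : ℝ) < h := Nat.cast_pos.mpr h0
  rw [maxDetBar, le_div_iff₀ (Real.rpow_pos_of_pos hpos _), one_mul]
  refine le_trans (le_of_eq ?_) (abs_det_le_maxDet A hA)
  have hdet : A.det ^ 2 = (h : ℝ) ^ h := by
    have := congrArg Matrix.det hAA
    rw [Matrix.det_mul, Matrix.det_transpose, Matrix.det_smul, Matrix.det_one, mul_one,
      Fintype.card_fin] at this
    rw [sq, this]
  rw [← Real.sqrt_sq_eq_abs, hdet, Real.sqrt_eq_rpow, ← Real.rpow_natCast, ← Real.rpow_mul hpos.le,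
    mul_one_div]

theorem maxDetBar_uniform_lower_bound (d : ℕ) :
    ∃ κ : ℝ, 0 < κ ∧ ∀ h : ℕ, 4 ≤ h → IsHadamardOrder h →
      maxDetBar (h + d) ≥ κ := by
  refine ⟨(5 / 27) ^ d, by positivity, fun h h4 hh => ?_⟩
  induction d with
  | zero => simpa using one_le_maxDetBar (by omega) hh
  | succ d ih =>
    have hstep := maxDetBar_succ_ge (n := h + d) (by omega)
    rw [← add_assoc, pow_succ']
    linarith
end
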